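/- Let n ≥ 3. There exists a smooth compactly supported function f : (0,∞) → ℝ, not identically zero, with ∫₀^∞ (f'(r)² − 2(n−2) f(r)²/r²) r^{n-1} dr < 0 if and only if n < 10. -/

import Mathlib

open MeasureTheory Set

/-- Completing the square in the quadratic form, with `a = (m + 1) / 2` and `n = m + 3`: the
integrands differ by the derivative of `a f² r^(m + 1)`, which integrates to zero. -/
lemma integral_instability_form_eq (m : ℕ) {f : ℝ → ℝ} (hf : ContDiff ℝ (⊤ : ℕ∞) f)
    (hc : HasCompactSupport f) :
    ∫ r in Ioi (0:ℝ), ((deriv f r) ^ 2 - 2 * ((m : ℝ) + 1) * (f r) ^ 2 / r ^ 2) * r ^ (m + 2) =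
    ∫ r in Ioi (0:ℝ), ((deriv f r + (m + 1) / 2 * f r / r) ^ 2
      - (m + 1) * (7 - m) / 4 * (f r) ^ 2 / r ^ 2) * r ^ (m + 2) := by
  have hfd : Differentiable ℝ f := hf.differentiable (by simp)
  have hdc : Continuous (deriv f) := hf.continuous_deriv (by simp)
  have hfc : Continuous f := hf.continuous
  set F : ℝ → ℝ := fun r ↦ (f r) ^ 2 * ((m + 1) / 2 * r ^ (m + 1)) with hF
  have hFd (r : ℝ) : HasDerivAt F
      (2 * f r * deriv f r * ((m + 1) / 2 * r ^ (m + 1))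
        + (f r) ^ 2 * ((m + 1) / 2 * ((m + 1) * r ^ m))) r := by
    have h := ((hfd r).hasDerivAt.pow 2).mul
      ((hasDerivAt_pow (m + 1) r).const_mul (((m : ℝ) + 1) / 2))
    refine h.congr_deriv ?_
    simp
  have hFs : ContDiff ℝ 1 F := by
    have := hf.of_le (m := 1) (by exact_mod_cast le_top)
    fun_prop
  have hFc : HasCompactSupport F :=
    (hc.comp_left (g := fun x : ℝ ↦ x ^ 2) (by simp)).mul_right
  have hFi : Integrable (deriv F) :=
    (hFs.continuous_deriv le_rfl).integrable_of_hasCompactSupport hFc.deriv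
  have hint : ∫ r in Ioi (0:ℝ), deriv F r = 0 := by
    rw [hFc.integral_Ioi_deriv_eq hFs]; simp [hF]
  have hGi : Integrable
      (fun r ↦ (deriv f r) ^ 2 * r ^ (m + 2) - (f r) ^ 2 * (2 * ((m : ℝ) + 1) * r ^ m)) := by
    refine Continuous.integrable_of_hasCompactSupport (by fun_prop) ?_
    exact (hc.deriv.comp_left (g := fun x : ℝ ↦ x ^ 2) (by simp)).mul_right.sub
      (hc.comp_left (g := fun x : ℝ ↦ x ^ 2) (by simp)).mul_right
  calc _ = ∫ r in Ioi (0:ℝ),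
        ((deriv f r) ^ 2 * r ^ (m + 2) - (f r) ^ 2 * (2 * ((m : ℝ) + 1) * r ^ m)) := by
        refine setIntegral_congr_fun measurableSet_Ioi fun r (hr : 0 < r) ↦ ?_
        field
    _ = ∫ r in Ioi (0:ℝ),
        ((deriv f r) ^ 2 * r ^ (m + 2) - (f r) ^ 2 * (2 * ((m : ℝ) + 1) * r ^ m) + deriv F r) := by
        rw [integral_add hGi.integrableOn hFi.integrableOn, hint, add_zero]
    _ = _ := by
        refine setIntegral_congr_fun measurableSet_Ioi fun r (hr : 0 < r) ↦ ?_
        simp only [(hFd r).deriv]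
        field

/-- Transplanting a test function on `ℝ` to `(0, ∞)` by `f r = r ^ (-a) φ (log r)`. -/
noncomputable def logTransplant (a : ℝ) (φ : ℝ → ℝ) : ℝ → ℝ :=
  (Ioi (0:ℝ)).indicator fun r ↦ Real.exp (-a * Real.log r) * φ (Real.log r)

section logTransplant

variable (a : ℝ) {φ : ℝ → ℝ}

lemma logTransplant_eventuallyEq {r : ℝ} (hr : 0 < r) :
    logTransplant a φ =ᶠ[nhds r] fun r ↦ Real.exp (-a * Real.log r) * φ (Real.log r) :=
  Filter.mem_of_superset (Ioi_mem_nhds hr) fun _ hx ↦ indicator_of_mem hx _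

lemma tsupport_logTransplant_subset (hc : HasCompactSupport φ) :
    tsupport (logTransplant a φ) ⊆ Real.exp '' tsupport φ := by
  refine closure_minimal (fun r hr ↦ ?_) (hc.isCompact.image Real.continuous_exp).isClosed
  obtain ⟨hr0, hr1⟩ : 0 < r ∧ φ (Real.log r) ≠ 0 := by
    simpa [logTransplant, indicator] using hr
  exact ⟨Real.log r, subset_tsupport _ hr1, Real.exp_log hr0⟩

lemma tsupport_logTransplant_subset_Ioi (hc : HasCompactSupport φ) :
    tsupport (logTransplant a φ) ⊆ Ioi 0 := by
  refine (tsupport_logTransplant_subset a hc).trans ?_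
  rintro _ ⟨t, -, rfl⟩
  exact Real.exp_pos t

lemma hasCompactSupport_logTransplant (hc : HasCompactSupport φ) :
    HasCompactSupport (logTransplant a φ) :=
  (hc.isCompact.image Real.continuous_exp).of_isClosed_subset (isClosed_tsupport _)
    (tsupport_logTransplant_subset a hc)

lemma contDiff_logTransplant {k : WithTop ℕ∞} (hφ : ContDiff ℝ k φ) (hc : HasCompactSupport φ) :
    ContDiff ℝ k (logTransplant a φ) := by
  refine contDiff_iff_contDiffAt.2 fun r ↦ ?_
  by_cases hr : r ∈ tsupport (logTransplant a φ)
  swap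
  · exact contDiffAt_const.congr_of_eventuallyEq (notMem_tsupport_iff_eventuallyEq.1 hr)
  have hr0 : 0 < r := tsupport_logTransplant_subset_Ioi a hc hr
  have hl : ContDiffAt ℝ k Real.log r := Real.contDiffAt_log.2 hr0.ne'
  exact ((contDiffAt_const.mul hl).exp.mul (hφ.contDiffAt.comp r hl)).congr_of_eventuallyEq
    (logTransplant_eventuallyEq a hr0)

lemma logTransplant_exp (t : ℝ) : logTransplant a φ (Real.exp t) = Real.exp (-a * t) * φ t := by
  simp [logTransplant, Real.exp_pos]

lemma hasDerivAt_logTransplant (hφ : Differentiable ℝ φ) {r : ℝ} (hr : 0 < r) :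
    HasDerivAt (logTransplant a φ)
      (Real.exp (-a * Real.log r) * (deriv φ (Real.log r) - a * φ (Real.log r)) / r) r := by
  have hl := Real.hasDerivAt_log hr.ne'
  have h := (hl.const_mul (-a)).exp.mul ((hφ _).hasDerivAt.comp r hl)
  refine (h.congr_of_eventuallyEq (logTransplant_eventuallyEq a hr)).congr_deriv ?_
  simp only [Function.comp_apply]
  field

end logTransplant

/-- On transplanted functions the instability form is a one-dimensional Schrödinger form with
constant potential. -/
lemma integral_instability_form_logTransplant (m : ℕ) {φ : ℝ → ℝ}
    (hφ : ContDiff ℝ (⊤ : ℕ∞) φ) (hc : HasCompactSupport φ) :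
    ∫ r in Ioi (0:ℝ), ((deriv (logTransplant ((m + 1) / 2) φ) r) ^ 2
        - 2 * ((m : ℝ) + 1) * (logTransplant ((m + 1) / 2) φ r) ^ 2 / r ^ 2) * r ^ (m + 2) =
    ∫ t : ℝ, ((deriv φ t) ^ 2 - (m + 1) * (7 - m) / 4 * (φ t) ^ 2) := by
  rw [integral_instability_form_eq m (contDiff_logTransplant _ hφ hc)
    (hasCompactSupport_logTransplant _ hc), ← Real.range_exp, ← image_univ,
    integral_image_eq_integral_abs_deriv_smul MeasurableSet.univ
      (fun t _ ↦ (Real.hasDerivAt_exp t).hasDerivWithinAt) Real.exp_injective.injOn,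
    setIntegral_univ]
  congr 1 with t
  have hE : Real.exp (-(((m : ℝ) + 1) / 2) * t) ^ 2 * Real.exp t ^ (m + 1) = 1 := by
    rw [← Real.exp_nat_mul, ← Real.exp_nat_mul, ← Real.exp_add, Real.exp_eq_one_iff]
    push_cast
    ring
  have hy := Real.exp_pos t
  rw [(hasDerivAt_logTransplant _ (hφ.differentiable (by simp)) hy).deriv, logTransplant_exp,
    Real.log_exp, abs_of_pos hy, smul_eq_mul]
  generalize Real.exp (-(((m : ℝ) + 1) / 2) * t) = E at *
  generalize Real.exp t = y at *
  rw [← mul_one ((deriv φ t) ^ 2 - _), ← hE]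
  field

/-- A positive constant beats the Dirichlet energy of slowly varying test functions. -/
lemma exists_integral_deriv_sq_sub_neg {c : ℝ} (hc : 0 < c) :
    ∃ φ : ℝ → ℝ, ContDiff ℝ (⊤ : ℕ∞) φ ∧ HasCompactSupport φ ∧
      ∫ t : ℝ, ((deriv φ t) ^ 2 - c * (φ t) ^ 2) < 0 := by
  let χ : ContDiffBump (0 : ℝ) := ⟨1, 2, one_pos, one_lt_two⟩
  have hχ : ContDiff ℝ (⊤ : ℕ∞) χ := χ.contDiff
  have hχc : Continuous χ := χ.continuous
  have hdc : Continuous (deriv χ) := hχ.continuous_deriv (by simp)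
  have hs : HasCompactSupport fun t ↦ (χ t) ^ 2 :=
    χ.hasCompactSupport.comp_left (g := fun x : ℝ ↦ x ^ 2) (by simp)
  have hds : HasCompactSupport fun t ↦ (deriv χ t) ^ 2 :=
    χ.hasCompactSupport.deriv.comp_left (g := fun x : ℝ ↦ x ^ 2) (by simp)
  have hi : Integrable fun t ↦ (χ t) ^ 2 := (hχc.pow 2).integrable_of_hasCompactSupport hs
  have hdi : Integrable fun t ↦ (deriv χ t) ^ 2 := (hdc.pow 2).integrable_of_hasCompactSupport hds
  have hK : 0 < ∫ t, (χ t) ^ 2 :=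
    (hχc.pow 2).integral_pos_of_hasCompactSupport_nonneg_nonzero hs (fun t ↦ sq_nonneg _) (x := 0)
      (by simp [χ.eventuallyEq_one.eq_of_nhds])
  have hD : 0 ≤ ∫ t, (deriv χ t) ^ 2 := integral_nonneg fun t ↦ sq_nonneg _
  set K := ∫ t, (χ t) ^ 2
  set D := ∫ t, (deriv χ t) ^ 2
  obtain ⟨ε, hε, hεD⟩ : ∃ ε : ℝ, 0 < ε ∧ ε ^ 2 * D < c * K := by
    refine ⟨√(c * K / (D + 1)), by positivity, ?_⟩
    rw [Real.sq_sqrt (by positivity), div_mul_eq_mul_div, div_lt_iff₀ (by positivity)]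
    nlinarith [mul_pos hc hK]
  refine ⟨fun t ↦ χ (ε * t), hχ.comp (contDiff_const.mul contDiff_id),
    χ.hasCompactSupport.comp_homeomorph (Homeomorph.mulLeft₀ ε hε.ne'), ?_⟩
  have hd (t : ℝ) : deriv (fun t ↦ χ (ε * t)) t = ε * deriv χ (ε * t) := by
    simpa using deriv_comp_mul_left ε χ t
  simp only [hd, mul_pow]
  rw [Measure.integral_comp_mul_left (fun t ↦ ε ^ 2 * (deriv χ t) ^ 2 - c * (χ t) ^ 2) ε,
    integral_sub (hdi.const_mul _) (hi.const_mul _), integral_const_mul, integral_const_mul,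
    smul_eq_mul]
  exact mul_neg_of_pos_of_neg (by positivity) (sub_neg.2 hεD)

/-- The quadratic form `f ↦ ∫₀^∞ (f'² − 2(n−2) f²/r²) r^(n−1) dr` admits a nonzero
smooth compactly supported negative direction if and only if `n < 10`. -/
theorem instability_quadratic_form_negative_iff (n : ℕ) (hn : 3 ≤ n) :
    (∃ f : ℝ → ℝ, ContDiff ℝ (⊤ : ℕ∞) f ∧ HasCompactSupport f ∧ tsupport f ⊆ Ioi 0 ∧ f ≠ 0 ∧
      ∫ r in Ioi (0:ℝ),
        ((deriv f r) ^ 2 - 2 * ((n : ℝ) - 2) * (f r) ^ 2 / r ^ 2) * r ^ (n - 1) < 0)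
    ↔ n < 10 := by
  obtain ⟨m, rfl⟩ := Nat.exists_eq_add_of_le' hn
  have hcast : ((m + 3 : ℕ) : ℝ) - 2 = m + 1 := by push_cast; ring
  rw [hcast, show m + 3 - 1 = m + 2 by omega]
  constructor
  · rintro ⟨f, hf, hc, -, -, hneg⟩
    by_contra! hm
    have hm' : (7 : ℝ) ≤ m := by exact_mod_cast (by omega : 7 ≤ m)
    rw [integral_instability_form_eq m hf hc] at hneg
    refine hneg.not_ge (setIntegral_nonneg measurableSet_Ioi fun r (hr : 0 < r) ↦ ?_)
    refine mul_nonneg (sub_nonneg.2 (le_trans ?_ (sq_nonneg _))) (by positivity)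
    have : ((m : ℝ) + 1) * (7 - m) / 4 ≤ 0 := by nlinarith
    exact div_nonpos_of_nonpos_of_nonneg (mul_nonpos_of_nonpos_of_nonneg this (sq_nonneg _))
      (sq_nonneg _)
  · intro hm
    have hm' : (m : ℝ) < 7 := by exact_mod_cast (by omega : m < 7)
    have hpos : 0 < ((m : ℝ) + 1) * (7 - m) / 4 := by
      have := sub_pos.2 hm'
      positivity
    obtain ⟨φ, hφ, hc, hneg⟩ := exists_integral_deriv_sq_sub_neg hpos
    rw [← integral_instability_form_logTransplant m hφ hc] at hneg
    refine ⟨_, contDiff_logTransplant _ hφ hc, hasCompactSupport_logTransplant _ hc,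
      tsupport_logTransplant_subset_Ioi _ hc, fun h ↦ ?_, hneg⟩
    simp [h] at hneg
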